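/- Let P be a d-polytope with d+s vertices (2 ≤ s ≤ d) such that f_k(P) = φ_k(d+s,d) for some 1 ≤ k ≤ d-2. Then every facet of P has exactly d, d+s-2, or d+s-1 vertices, and P has exactly d+2 facets. -/

import Mathlib

open Set

/-- `C n m` : binomial coefficient with the convention `C n m = 0` for `n < 0`. -/
def C (n : ℤ) (m : ℕ) : ℤ := if n < 0 then 0 else (n.toNat).choose m

/-- Grünbaum's lower bound function `φ_k(d+s, d)`. -/
def phi (d s k : ℕ) : ℤ := C (d + 1) (k + 1) + C d (k + 1) - C ((d : ℤ) + 1 - s) (k + 1)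

/-- A polytope: convex hull of a finite set of points. -/
def IsPolytope {N : ℕ} (P : Set (EuclideanSpace ℝ (Fin N))) : Prop :=
  ∃ V : Finset (EuclideanSpace ℝ (Fin N)), P = convexHull ℝ (V : Set (EuclideanSpace ℝ (Fin N)))

/-- The dimension of a set: the dimension of its affine span. -/
noncomputable def pdim {N : ℕ} (P : Set (EuclideanSpace ℝ (Fin N))) : ℕ :=
  Module.finrank ℝ (affineSpan ℝ P).direction

/-- `F` is a face of `P`: the intersection of `P` with a supporting hyperplane
(the linear functional may be zero, so `P` itself is a face; `F` may be empty). -/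
def IsFace {N : ℕ} (P F : Set (EuclideanSpace ℝ (Fin N))) : Prop :=
  ∃ (f : EuclideanSpace ℝ (Fin N) →ₗ[ℝ] ℝ) (c : ℝ),
    (∀ x ∈ P, f x ≤ c) ∧ F = {x ∈ P | f x = c}

/-- The set of vertices of `P` (points whose singleton is a face of `P`). -/
def vertexSet {N : ℕ} (P : Set (EuclideanSpace ℝ (Fin N))) : Set (EuclideanSpace ℝ (Fin N)) :=
  {v | IsFace P {v}}

/-- The number of (nonempty) `k`-dimensional faces of `P`. -/
noncomputable def fCount {N : ℕ} (P : Set (EuclideanSpace ℝ (Fin N))) (k : ℕ) : ℕ :=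
  {F : Set (EuclideanSpace ℝ (Fin N)) | IsFace P F ∧ F.Nonempty ∧ pdim F = k}.ncard

/-- `P` is a `k`-dimensional simplex. -/
def IsSimplex {N : ℕ} (P : Set (EuclideanSpace ℝ (Fin N))) (k : ℕ) : Prop :=
  ∃ V : Finset (EuclideanSpace ℝ (Fin N)), V.card = k + 1 ∧
    AffineIndependent ℝ (Subtype.val : {x // x ∈ V} → EuclideanSpace ℝ (Fin N)) ∧
    P = convexHull ℝ (V : Set (EuclideanSpace ℝ (Fin N)))

/-- `Q` is a pyramid over `P`. -/
def IsPyramid {N : ℕ} (Q P : Set (EuclideanSpace ℝ (Fin N))) : Prop :=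
  ∃ x, x ∉ affineSpan ℝ P ∧ Q = convexHull ℝ (insert x P)

/-- `Q` is an `r`-fold pyramid over `P`. -/
def IsFoldPyramid {N : ℕ} : ℕ → Set (EuclideanSpace ℝ (Fin N)) → Set (EuclideanSpace ℝ (Fin N)) → Prop
  | 0, Q, P => Q = P
  | (r + 1), Q, P => ∃ R, IsFoldPyramid r R P ∧ IsPyramid Q R

/-- `Q` is a bipyramid over `P`: the two apices span a segment whose interior
meets the relative interior of `P`. -/
def IsBipyramid {N : ℕ} (Q P : Set (EuclideanSpace ℝ (Fin N))) : Prop :=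
  ∃ x y, x ∉ affineSpan ℝ P ∧ y ∉ affineSpan ℝ P ∧
    (openSegment ℝ x y ∩ intrinsicInterior ℝ P).Nonempty ∧
    Q = convexHull ℝ (P ∪ {x, y})

/-- `Q` is the direct sum (free sum) of `P₁` and `P₂`: their affine spans meet in a single
point that is in the relative interior of each. -/
def IsDirectSum {N : ℕ} (Q P₁ P₂ : Set (EuclideanSpace ℝ (Fin N))) : Prop :=
  ∃ z, (affineSpan ℝ P₁ : Set (EuclideanSpace ℝ (Fin N))) ∩ (affineSpan ℝ P₂) = {z} ∧
    z ∈ intrinsicInterior ℝ P₁ ∧ z ∈ intrinsicInterior ℝ P₂ ∧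
    Q = convexHull ℝ (P₁ ∪ P₂)

/-- Combinatorial equivalence: an inclusion-preserving bijection between face lattices. -/
def CombEquiv {N M : ℕ} (P : Set (EuclideanSpace ℝ (Fin N))) (Q : Set (EuclideanSpace ℝ (Fin M))) : Prop :=
  Nonempty ({F : Set (EuclideanSpace ℝ (Fin N)) // IsFace P F} ≃o
    {G : Set (EuclideanSpace ℝ (Fin M)) // IsFace Q G})

/-- `P` is combinatorially dual to `Q`: its face lattice is that of `Q` reversed. -/
def DualCombEquiv {N M : ℕ} (P : Set (EuclideanSpace ℝ (Fin N))) (Q : Set (EuclideanSpace ℝ (Fin M))) : Prop :=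
  Nonempty ({F : Set (EuclideanSpace ℝ (Fin N)) // IsFace P F} ≃o
    ({G : Set (EuclideanSpace ℝ (Fin M)) // IsFace Q G})ᵒᵈ)

/-- `P` (of dimension `d`) is simplicial: all its facets are simplices. -/
def IsSimplicial {N : ℕ} (P : Set (EuclideanSpace ℝ (Fin N))) (d : ℕ) : Prop :=
  ∀ F, IsFace P F → F.Nonempty → pdim F = d - 1 → IsSimplex F (d - 1)

/-- `ρ` is a grading of a finite meet-semilattice in which every lower interval is coatomistic. -/
structure FaceRank {L : Type*} [SemilatticeInf L] (ρ : L → ℕ) : Prop where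
  strictMono : StrictMono ρ
  exists_facet : ∀ x y G : L, x ≤ G → y ≤ G → ¬ y ≤ x →
    ∃ H, x ≤ H ∧ H ≤ G ∧ ρ H + 1 = ρ G ∧ ¬ y ≤ H

namespace FaceRank

variable {L : Type*} [SemilatticeInf L] {ρ : L → ℕ}

lemma eq_of_le (h : FaceRank ρ) {x y : L} (hxy : x ≤ y) (hr : ρ y ≤ ρ x) : x = y := by
  by_contra hne
  have := h.strictMono (lt_of_le_of_ne hxy hne)
  omega

lemma not_le_of_rank_lt (h : FaceRank ρ) {x y : L} (hr : ρ x < ρ y) : ¬ y ≤ x := fun hyx => by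
  have := h.strictMono.monotone hyx
  omega

lemma exists_cover (h : FaceRank ρ) {x H : L} (hxH : x ≤ H) :
    ∀ (n : ℕ) (G : L), ρ G = n → x ≤ G → ¬ G ≤ H →
      ∃ A, x ≤ A ∧ A ≤ G ∧ ρ A = ρ x + 1 ∧ ¬ A ≤ H := by
  intro n
  induction n using Nat.strong_induction_on with
  | _ n ih =>
    intro G hn hxG hGH
    by_cases hy : ∃ y, x ≤ y ∧ y < G ∧ ¬ y ≤ H
    · obtain ⟨y, hxy, hyG, hyH⟩ := hy
      obtain ⟨A, h1, h2, h3, h4⟩ := ih (ρ y) (hn ▸ h.strictMono hyG) y rfl hxy hyH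
      exact ⟨A, h1, h2.trans hyG.le, h3, h4⟩
    · push Not at hy
      have hxltG : x < G := lt_of_le_of_ne hxG (by rintro rfl; exact hGH hxH)
      have hr := h.strictMono hxltG
      by_cases hr1 : ρ G = ρ x + 1
      · exact ⟨G, hxG, le_rfl, hr1, hGH⟩
      exfalso
      have key : ∀ K, x ≤ K → K ≤ G → ρ K + 1 = ρ G → K = G ⊓ H := by
        intro K hxK hKG hK
        have hKlt : K < G := lt_of_le_of_ne hKG (by rintro rfl; omega)
        refine h.eq_of_le (le_inf hKG (hy K hxK hKlt)) ?_
        have : G ⊓ H < G := lt_of_le_of_ne inf_le_left (fun e => hGH (inf_eq_left.1 e))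
        have := h.strictMono this
        omega
      obtain ⟨H₁, h1, h2, h3, -⟩ := h.exists_facet x G G hxG le_rfl (not_le_of_gt hxltG)
      obtain ⟨H₂, h4, h5, h6, h7⟩ := h.exists_facet x H₁ G hxG h2
        (h.not_le_of_rank_lt (by omega))
      exact h7 (by rw [key H₁ h1 h2 h3, key H₂ h4 h5 h6])

/-- There is a face through the vertex `v` avoiding a prescribed small set of other vertices. -/
lemma exists_avoiding (h : FaceRank ρ) {v G : L} (hv : ρ v = 1) (hvG : v ≤ G) {d : ℕ}
    (hG : ρ G = d + 1) (S : Finset L) (hS : ∀ u ∈ S, ρ u = 1) (hvS : v ∉ S) (hSd : S.card ≤ d) :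
    ∃ F, v ≤ F ∧ F ≤ G ∧ (∀ u ∈ S, ¬ u ≤ F) ∧ ρ F = d - S.card + 1 := by
  classical
  induction S using Finset.induction_on with
  | empty => exact ⟨G, hvG, le_rfl, by simp, by simpa using hG⟩
  | insert u S hu ih =>
    rw [Finset.card_insert_of_notMem hu] at hSd ⊢
    rw [Finset.mem_insert, not_or] at hvS
    obtain ⟨F, f1, f2, f3, f4⟩ := ih (fun w hw => hS w (Finset.mem_insert_of_mem hw)) hvS.2
      (by omega)
    have hu1 := hS u (Finset.mem_insert_self _ _)
    have huv : ¬ u ≤ v := fun huv => hvS.1 (h.eq_of_le huv (by omega)).symm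
    obtain ⟨H, g1, g2, g3, g4⟩ : ∃ H, v ≤ H ∧ H ≤ F ∧ ρ H + 1 = ρ F ∧ ¬ u ≤ H := by
      by_cases huF : u ≤ F
      · exact h.exists_facet v u F f1 huF huv
      · obtain ⟨H, g1, g2, g3, -⟩ := h.exists_facet v F F f1 le_rfl
          (h.not_le_of_rank_lt (by omega))
        exact ⟨H, g1, g2, g3, fun e => huF (e.trans g2)⟩
    refine ⟨H, g1, g2.trans f2, ?_, by omega⟩
    intro w hw
    rcases Finset.mem_insert.1 hw with rfl | hw
    · exact g4
    · exact fun e => f3 w hw (e.trans g2)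

variable [Fintype L]

open scoped Classical in
/-- The elements of rank `j` in the interval `[x, G]`. -/
noncomputable def ivl (ρ : L → ℕ) (x G : L) (j : ℕ) :
    Finset L :=
  Finset.univ.filter fun F => x ≤ F ∧ F ≤ G ∧ ρ F = j

open scoped Classical in
/-- The elements of rank `j` below `G` that lie above some element of `S` but above no element
of `S₀`. -/
noncomputable def hits (ρ : L → ℕ) (G : L)
    (S₀ S : Finset L) (j : ℕ) : Finset L :=
  Finset.univ.filter fun F => F ≤ G ∧ ρ F = j ∧ (∀ u ∈ S₀, ¬ u ≤ F) ∧ ∃ v ∈ S, v ≤ F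

lemma mem_ivl {x G F : L} {j : ℕ} : F ∈ ivl ρ x G j ↔ x ≤ F ∧ F ≤ G ∧ ρ F = j := by
  simp [ivl]

lemma mem_hits {G F : L} {S₀ S : Finset L} {j : ℕ} :
    F ∈ hits ρ G S₀ S j ↔ F ≤ G ∧ ρ F = j ∧ (∀ u ∈ S₀, ¬ u ≤ F) ∧ ∃ v ∈ S, v ≤ F := by
  simp [hits]

lemma choose_le_card_ivl (h : FaceRank ρ) :
    ∀ (n k : ℕ) (x G : L), x ≤ G → ρ G = ρ x + n → n.choose k ≤ (ivl ρ x G (ρ x + k)).card := by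
  classical
  intro n
  induction n with
  | zero =>
    intro k x G hxG hG
    rcases k with _ | k
    · exact Finset.card_pos.2 ⟨x, mem_ivl.2 ⟨le_rfl, hxG, rfl⟩⟩
    · simp
  | succ n ih =>
    intro k x G hxG hG
    rcases k with _ | k
    · simpa using Finset.card_pos.2 ⟨x, mem_ivl.2 ⟨le_rfl, hxG, rfl⟩⟩
    · have hGx := h.not_le_of_rank_lt (x := x) (y := G) (by omega)
      obtain ⟨H, h1, h2, h3, h4⟩ := h.exists_facet x G G hxG le_rfl hGx
      obtain ⟨A, h5, h6, h7, h8⟩ := h.exists_cover h1 _ G rfl hxG h4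
      have i1 := ih (k + 1) x H h1 (by omega)
      have i2 := ih k A G h6 (by omega)
      have hd : Disjoint (ivl ρ A G (ρ A + k)) (ivl ρ x H (ρ x + (k + 1))) := by
        rw [Finset.disjoint_left]
        intro F hF hF'
        rw [mem_ivl] at hF hF'
        exact h8 (hF.1.trans hF'.2.1)
      have hsub : ivl ρ A G (ρ A + k) ∪ ivl ρ x H (ρ x + (k + 1)) ⊆ ivl ρ x G (ρ x + (k + 1)) := by
        intro F hF
        rw [Finset.mem_union, mem_ivl, mem_ivl] at hF
        rw [mem_ivl]
        rcases hF with hF | hF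
        · exact ⟨h5.trans hF.1, hF.2.1, by omega⟩
        · exact ⟨hF.1, hF.2.1.trans h2, by omega⟩
      have := Finset.card_le_card hsub
      rw [Finset.card_union_of_disjoint hd] at this
      rw [Nat.choose_succ_succ']
      omega

lemma exists_between (h : FaceRank ρ) {x G : L} (hxG : x ≤ G) {j : ℕ} (hj : ρ x ≤ j)
    (hjG : j ≤ ρ G) : ∃ B, x ≤ B ∧ B ≤ G ∧ ρ B = j := by
  have := h.choose_le_card_ivl (ρ G - ρ x) (j - ρ x) x G hxG (by omega)
  have hp : 0 < (ρ G - ρ x).choose (j - ρ x) := Nat.choose_pos (by omega)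
  obtain ⟨B, hB⟩ := Finset.card_pos.1 (hp.trans_le this)
  rw [mem_ivl] at hB
  exact ⟨B, hB.1, hB.2.1, by omega⟩

/-- An element above `x` not contained in `F` has a face of any prescribed intermediate rank
above `x` that is not contained in `F`. -/
lemma exists_rank_not_le (h : FaceRank ρ) {x F K : L} (hxF : x ≤ F) (hxK : x ≤ K)
    (hKF : ¬ K ≤ F) {j : ℕ} (hj : ρ x + 1 ≤ j) (hjK : j ≤ ρ K) :
    ∃ B, x ≤ B ∧ B ≤ K ∧ ρ B = j ∧ ¬ B ≤ F := by
  obtain ⟨A, h1, h2, h3, h4⟩ := h.exists_cover hxF _ K rfl hxK hKF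
  obtain ⟨B, h5, h6, h7⟩ := h.exists_between h2 (j := j) (by omega) hjK
  exact ⟨B, h1.trans h5, h6, h7, fun hB => h4 (h5.trans hB)⟩

/-- If an interval of length `n` has at most `n` atoms, then it has at most `n` coatoms. -/
lemma card_coatoms_le_of_card_atoms_le (h : FaceRank ρ) {n : ℕ} {x G : L}
    (hG : ρ G = ρ x + n) (hn : 2 ≤ n) (hc : (ivl ρ x G (ρ x + 1)).card ≤ n) :
    (ivl ρ x G (ρ x + (n - 1))).card ≤ n := by
  classical
  refine le_trans ?_ hc
  have hex : ∀ K : L, K ∈ ivl ρ x G (ρ x + (n - 1)) →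
      ∃ A, x ≤ A ∧ A ≤ G ∧ ρ A = ρ x + 1 ∧ ¬ A ≤ K := by
    intro K hK
    rw [mem_ivl] at hK
    exact h.exists_cover hK.1 _ G rfl (hK.1.trans hK.2.1) (h.not_le_of_rank_lt (by omega))
  choose! m hm using hex
  refine Finset.card_le_card_of_injOn m (fun K hK => ?_) ?_
  · have := hm K hK
    exact mem_ivl.2 ⟨this.1, this.2.1, this.2.2.1⟩
  · intro K hK K' hK' hmm
    by_contra hne
    have a1 := hm K hK
    have a2 := hm K' hK'
    have hK1 := mem_ivl.1 hK
    have hK2 := mem_ivl.1 hK'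
    have hnle : ¬ K ≤ K' := fun hle => hne (h.eq_of_le hle (by omega))
    obtain ⟨b, b1, b2, b3, b4⟩ := h.exists_cover hK2.1 _ K rfl hK1.1 hnle
    have hmb : m K ≠ b := by
      intro e
      exact a1.2.2.2 (e ▸ b2)
    have i1 := h.choose_le_card_ivl (n - 1) 1 x K' hK2.1 (by omega)
    have hsub : insert (m K) (insert b (ivl ρ x K' (ρ x + 1))) ⊆ ivl ρ x G (ρ x + 1) := by
      intro F hF
      rw [Finset.mem_insert, Finset.mem_insert, mem_ivl] at hF
      rw [mem_ivl]
      rcases hF with rfl | rfl | hF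
      · exact ⟨a1.1, a1.2.1, a1.2.2.1⟩
      · exact ⟨b1, b2.trans hK1.2.1, b3⟩
      · exact ⟨hF.1, hF.2.1.trans hK2.2.1, hF.2.2⟩
    have := Finset.card_le_card hsub
    rw [Finset.card_insert_of_notMem, Finset.card_insert_of_notMem] at this
    · rw [Nat.choose_one_right] at i1
      omega
    · intro hb
      exact b4 (mem_ivl.1 hb).2.1
    · intro hb
      rw [Finset.mem_insert, mem_ivl] at hb
      rcases hb with hb | hb
      · exact hmb hb
      · exact a2.2.2.2 (hmm ▸ hb.2.1)

/-- If an interval of length `n` attains the lower bound `n.choose k` in one intermediate rank,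
then it has at most `n` coatoms. -/
lemma card_coatoms_le (h : FaceRank ρ) :
    ∀ (k n : ℕ) (x G : L), x ≤ G → ρ G = ρ x + n → 1 ≤ k → k + 1 ≤ n →
      (ivl ρ x G (ρ x + k)).card ≤ n.choose k → (ivl ρ x G (ρ x + (n - 1))).card ≤ n := by
  classical
  intro k
  induction k with
  | zero => intro n x G _ _ hk; omega
  | succ k ih =>
    intro n x G hxG hG _ hkn hc
    rcases Nat.eq_zero_or_pos k with rfl | hk
    · exact h.card_coatoms_le_of_card_atoms_le hG (by omega) (by simpa using hc)
    obtain ⟨n, rfl⟩ : ∃ n', n = n' + 1 := ⟨n - 1, by omega⟩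
    have hGx := h.not_le_of_rank_lt (x := x) (y := G) (by omega)
    obtain ⟨H, h1, h2, h3, h4⟩ := h.exists_facet x G G hxG le_rfl hGx
    obtain ⟨A, h5, h6, h7, h8⟩ := h.exists_cover h1 _ G rfl hxG h4
    have i1 := h.choose_le_card_ivl n (k + 1) x H h1 (by omega)
    have i2 := h.choose_le_card_ivl n k A G h6 (by omega)
    rw [Nat.choose_succ_succ'] at hc
    have hd : Disjoint (ivl ρ A G (ρ A + k)) (ivl ρ x H (ρ x + (k + 1))) := by
      rw [Finset.disjoint_left]
      intro F hF hF'
      rw [mem_ivl] at hF hF'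
      exact h8 (hF.1.trans hF'.2.1)
    have hsub : ivl ρ A G (ρ A + k) ∪ ivl ρ x H (ρ x + (k + 1)) ⊆ ivl ρ x G (ρ x + (k + 1)) := by
      intro F hF
      rw [Finset.mem_union, mem_ivl, mem_ivl] at hF
      rw [mem_ivl]
      rcases hF with hF | hF
      · exact ⟨h5.trans hF.1, hF.2.1, by omega⟩
      · exact ⟨hF.1, hF.2.1.trans h2, by omega⟩
    have hcard := Finset.card_le_card hsub
    rw [Finset.card_union_of_disjoint hd] at hcard
    have heq := Finset.eq_of_subset_of_card_le hsub
      (by rw [Finset.card_union_of_disjoint hd]; omega)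
    have hA := ih n A G h6 (by omega) hk (by omega) (by omega)
    have hcov : ivl ρ x G (ρ x + (n + 1 - 1)) ⊆ insert H (ivl ρ A G (ρ A + (n - 1))) := by
      intro K hK
      rw [mem_ivl] at hK
      rw [Finset.mem_insert, mem_ivl]
      by_cases hKH : K ≤ H
      · exact Or.inl (h.eq_of_le hKH (by omega))
      obtain ⟨B, b1, b2, b3, b4⟩ := h.exists_rank_not_le h1 hK.1 hKH (j := ρ x + (k + 1))
        (by omega) (by omega)
      have hB : B ∈ ivl ρ x G (ρ x + (k + 1)) := mem_ivl.2 ⟨b1, b2.trans hK.2.1, b3⟩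
      rw [← heq, Finset.mem_union, mem_ivl, mem_ivl] at hB
      rcases hB with hB | hB
      · exact Or.inr ⟨hB.1.trans b2, hK.2.1, by omega⟩
      · exact absurd hB.2.1 b4
    have := (Finset.card_le_card hcov).trans (Finset.card_insert_le _ _)
    omega

lemma ivl_subset_hits {v F G : L} (hFG : F ≤ G) {S : Finset L} (hF : ∀ u ∈ S, ¬ u ≤ F) (j : ℕ) :
    ivl ρ v F j ⊆ hits ρ G S {v} j := by
  intro B hB
  rw [mem_ivl] at hB
  exact mem_hits.2 ⟨hB.2.1.trans hFG, hB.2.2, fun u hu e => hF u hu (e.trans hB.2.1),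
    v, Finset.mem_singleton_self v, hB.1⟩

lemma choose_le_card_hits_singleton (h : FaceRank ρ) {v G : L} (hv : ρ v = 1) (hvG : v ≤ G)
    {d k : ℕ} (hk : 1 ≤ k) (hG : ρ G = d + 1) (S : Finset L) (hS : ∀ u ∈ S, ρ u = 1)
    (hvS : v ∉ S) : (d - S.card).choose k ≤ (hits ρ G S {v} (k + 1)).card := by
  by_cases hSd : S.card ≤ d
  · obtain ⟨F, f1, f2, f3, f4⟩ := h.exists_avoiding hv hvG hG S hS hvS hSd
    have := h.choose_le_card_ivl (d - S.card) k v F f1 (by omega)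
    rw [hv, add_comm 1 k] at this
    exact this.trans (Finset.card_le_card (ivl_subset_hits f2 f3 _))
  · rw [show d - S.card = 0 by omega, Nat.choose_eq_zero_of_lt (by omega)]
    exact Nat.zero_le _

lemma card_hits_union [DecidableEq L] (G : L) (S₀ S T : Finset L) (j : ℕ) :
    (hits ρ G S₀ (S ∪ T) j).card = (hits ρ G S₀ S j).card + (hits ρ G (S₀ ∪ S) T j).card := by
  rw [← Finset.card_union_of_disjoint]
  · congr 1
    ext F
    simp only [Finset.mem_union, mem_hits]
    constructor
    · rintro ⟨h1, h2, h3, v, hv, hvF⟩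
      by_cases hSF : ∃ u ∈ S, u ≤ F
      · exact Or.inl ⟨h1, h2, h3, hSF⟩
      · push Not at hSF
        refine Or.inr ⟨h1, h2, ?_, v, ?_, hvF⟩
        · rintro u (hu | hu)
          exacts [h3 u hu, hSF u hu]
        · rcases hv with hv | hv
          exacts [absurd hvF (hSF v hv), hv]
    · rintro (⟨h1, h2, h3, v, hv, hvF⟩ | ⟨h1, h2, h3, v, hv, hvF⟩)
      · exact ⟨h1, h2, h3, v, Or.inl hv, hvF⟩
      · exact ⟨h1, h2, fun u hu => h3 u (Or.inl hu), v, Or.inr hv, hvF⟩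
  · rw [Finset.disjoint_left]
    intro F hF hF'
    rw [mem_hits] at hF hF'
    obtain ⟨v, hv, hvF⟩ := hF.2.2.2
    exact hF'.2.2.1 v (Finset.mem_union_right _ hv) hvF

lemma sum_choose_le_card_hits (h : FaceRank ρ) {G : L} {d k : ℕ} (hk : 1 ≤ k)
    (hG : ρ G = d + 1) (S : Finset L) (hS : ∀ u ∈ S, ρ u = 1 ∧ u ≤ G) :
    ∀ S₀ : Finset L, (∀ u ∈ S₀, ρ u = 1) → Disjoint S₀ S →
      ∑ i ∈ Finset.range S.card, (d - S₀.card - i).choose k ≤ (hits ρ G S₀ S (k + 1)).card := by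
  classical
  induction S using Finset.induction_on with
  | empty => intro S₀ _ _; simp
  | insert v S hv ih =>
    intro S₀ hS₀ hdis
    rw [Finset.disjoint_insert_right] at hdis
    have hv1 := hS v (Finset.mem_insert_self _ _)
    rw [Finset.insert_eq, card_hits_union, ← Finset.insert_eq, Finset.card_insert_of_notMem hv,
      Finset.sum_range_succ']
    have h1 := h.choose_le_card_hits_singleton hv1.1 hv1.2 hk hG S₀ hS₀ hdis.1
    have h2 := ih (fun u hu => hS u (Finset.mem_insert_of_mem hu)) (S₀ ∪ {v})
      (by
        intro u hu
        rw [Finset.mem_union, Finset.mem_singleton] at hu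
        rcases hu with hu | rfl
        exacts [hS₀ u hu, hv1.1])
      (by
        rw [Finset.disjoint_union_left, Finset.disjoint_singleton_left]
        exact ⟨hdis.2, hv⟩)
    rw [Finset.card_union_of_disjoint (by simpa using hdis.1), Finset.card_singleton] at h2
    have h3 : ∑ i ∈ Finset.range S.card, (d - S₀.card - (i + 1)).choose k
        = ∑ i ∈ Finset.range S.card, (d - (S₀.card + 1) - i).choose k :=
      Finset.sum_congr rfl fun i _ => by congr 1; omega
    rw [h3]
    simp only [Nat.sub_zero]
    omega

/-- Equality in `sum_choose_le_card_hits` forces equality for each step of each ordering. -/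
lemma card_hits_singleton_le (h : FaceRank ρ) {G : L} {d k : ℕ} (hk : 1 ≤ k)
    (hG : ρ G = d + 1) {S : Finset L} (hS : ∀ u ∈ S, ρ u = 1 ∧ u ≤ G)
    (hc : (hits ρ G ∅ S (k + 1)).card ≤ ∑ i ∈ Finset.range S.card, (d - i).choose k)
    {S₁ : Finset L} (hS₁ : S₁ ⊆ S) {v : L} (hv : v ∈ S) (hvS₁ : v ∉ S₁) :
    (hits ρ G S₁ {v} (k + 1)).card ≤ (d - S₁.card).choose k := by
  classical
  set T := S \ (S₁ ∪ {v}) with hT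
  have hsub : S₁ ∪ {v} ⊆ S := Finset.union_subset hS₁ (Finset.singleton_subset_iff.2 hv)
  have hSeq : (S₁ ∪ {v}) ∪ T = S := Finset.union_sdiff_of_subset hsub
  have hcard1 : (S₁ ∪ {v}).card = S₁.card + 1 := by
    rw [Finset.card_union_of_disjoint (by simpa using hvS₁), Finset.card_singleton]
  have hcard : S.card = S₁.card + 1 + T.card := by
    rw [← hcard1, ← Finset.card_union_of_disjoint Finset.disjoint_sdiff, hSeq]
  have e1 := card_hits_union (ρ := ρ) G ∅ (S₁ ∪ {v}) T (k + 1)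
  have e2 := card_hits_union (ρ := ρ) G ∅ S₁ {v} (k + 1)
  rw [hSeq, Finset.empty_union] at e1
  rw [Finset.empty_union] at e2
  have l1 := h.sum_choose_le_card_hits hk hG S₁ (fun u hu => hS u (hS₁ hu)) ∅ (by simp) (by simp)
  have l2 := h.sum_choose_le_card_hits hk hG T
    (fun u hu => hS u (Finset.sdiff_subset hu)) (S₁ ∪ {v}) (fun u hu => (hS u (hsub hu)).1)
    Finset.disjoint_sdiff
  rw [hcard, Finset.sum_range_add, Finset.sum_range_succ] at hc
  rw [hcard1] at l2
  simp only [Finset.card_empty, Nat.sub_zero] at l1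
  have h3 : ∑ i ∈ Finset.range T.card, (d - (S₁.card + 1) - i).choose k
      = ∑ i ∈ Finset.range T.card, (d - (S₁.card + 1 + i)).choose k :=
    Finset.sum_congr rfl fun i _ => by congr 1; omega
  omega

/-- If few faces of rank `k + 1` contain `v` and avoid `S`, then a face through `v` avoiding `S`
of the extremal rank contains all other such faces. -/
lemma le_of_card_hits_singleton_le (h : FaceRank ρ) {G F K v : L} {n k : ℕ} (hk : 1 ≤ k)
    {S : Finset L} (hv : ρ v = 1)
    (hc : (hits ρ G S {v} (k + 1)).card ≤ n.choose k)
    (hvF : v ≤ F) (hFG : F ≤ G) (hFS : ∀ u ∈ S, ¬ u ≤ F) (hF : ρ F = n + 1)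
    (hvK : v ≤ K) (hKG : K ≤ G) (hKS : ∀ u ∈ S, ¬ u ≤ K) (hK : k + 1 ≤ ρ K) : K ≤ F := by
  by_contra hKF
  have h1 := h.choose_le_card_ivl n k v F hvF (by omega)
  rw [hv, add_comm 1 k] at h1
  have heq := Finset.eq_of_subset_of_card_le (ivl_subset_hits (v := v) hFG hFS (k + 1))
    (hc.trans h1)
  obtain ⟨B, b1, b2, b3, b4⟩ := h.exists_rank_not_le hvF hvK hKF (j := k + 1) (by omega) hK
  have hB := ivl_subset_hits (v := v) hKG hKS (k + 1) (mem_ivl.2 ⟨b1, b2, b3⟩)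
  rw [← heq, mem_ivl] at hB
  exact b4 hB.2.1

/-- If every facet of `G` misses at most one vertex, then `G` has at most `ρ G` vertices. -/
lemma card_vertices_le (h : FaceRank ρ) {o G : L} (ho : ρ o = 0) (hbot : ∀ x, o ≤ x)
    (hall : ∀ F, F ≤ G → ρ F + 1 = ρ G → (ivl ρ o G 1).card ≤ (ivl ρ o F 1).card + 1) :
    (ivl ρ o G 1).card ≤ ρ G := by
  classical
  suffices H : ∀ S : Finset L, S ⊆ ivl ρ o G 1 →
      ∃ F, F ≤ G ∧ ρ F + S.card ≤ ρ G ∧ ∀ v ∈ ivl ρ o G 1, v ∉ S → v ≤ F by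
    obtain ⟨F, -, hF, -⟩ := H _ subset_rfl
    omega
  intro S
  induction S using Finset.induction_on with
  | empty => exact fun _ => ⟨G, le_rfl, by simp, fun v hv _ => (mem_ivl.1 hv).2.1⟩
  | insert v S hv ih =>
    intro hS
    rw [Finset.insert_subset_iff] at hS
    obtain ⟨F, f1, f2, f3⟩ := ih hS.2
    have hvG := mem_ivl.1 hS.1
    obtain ⟨H, -, g2, g3, g4⟩ := h.exists_facet o v G (hbot G) hvG.2.1
      (h.not_le_of_rank_lt (by omega))
    have hsub : ivl ρ o H 1 ⊆ (ivl ρ o G 1).erase v := by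
      intro u hu
      rw [mem_ivl] at hu
      rw [Finset.mem_erase, mem_ivl]
      exact ⟨by rintro rfl; exact g4 hu.2.1, hu.1, hu.2.1.trans g2, hu.2.2⟩
    have heq := Finset.eq_of_subset_of_card_le hsub (by
      rw [Finset.card_erase_of_mem hS.1]
      have := hall H g2 g3
      omega)
    have hlt : F ⊓ H < F := lt_of_le_of_ne inf_le_left fun e =>
      g4 ((f3 v hS.1 hv).trans (inf_eq_left.1 e))
    refine ⟨F ⊓ H, inf_le_left.trans f1, ?_, ?_⟩
    · have := h.strictMono hlt
      rw [Finset.card_insert_of_notMem hv]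
      omega
    · intro u hu huS
      rw [Finset.mem_insert, not_or] at huS
      have : u ∈ ivl ρ o H 1 := by rw [heq]; exact Finset.mem_erase.2 ⟨huS.1, hu⟩
      exact le_inf (f3 u hu huS.2) (mem_ivl.1 this).2.1

lemma sum_range_choose_sub (d k r : ℕ) (hr : r ≤ d + 1) :
    ∑ i ∈ Finset.range r, (d - i).choose k + (d + 1 - r).choose (k + 1)
      = (d + 1).choose (k + 1) := by
  induction r with
  | zero => simp
  | succ r ih =>
    rw [Finset.sum_range_succ, ← ih (by omega), show d + 1 - r = (d - r) + 1 by omega,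
      Nat.choose_succ_succ', show d + 1 - (r + 1) = d - r by omega]
    ring

lemma choose_add_choose_le (a p q k : ℕ) :
    (a + p).choose (k + 1) + (a + q).choose (k + 1)
      ≤ (a + p + q).choose (k + 1) + a.choose (k + 1) := by
  induction q with
  | zero => simp
  | succ q ih =>
    have h1 := Nat.choose_le_choose k (show a + q ≤ a + p + q by omega)
    rw [← add_assoc, ← add_assoc, Nat.choose_succ_succ' (a + q), Nat.choose_succ_succ' (a + p + q)]
    omega

lemma choose_add_choose_lt {a p q k : ℕ} (hp : 1 ≤ p) (hq : 1 ≤ q) (hk : 1 ≤ k)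
    (hka : k + 1 ≤ a + p + q) :
    (a + p).choose (k + 1) + (a + q).choose (k + 1)
      < (a + p + q).choose (k + 1) + a.choose (k + 1) := by
  obtain ⟨q, rfl⟩ : ∃ q', q = q' + 1 := ⟨q - 1, by omega⟩
  obtain ⟨p, rfl⟩ : ∃ p', p = p' + 1 := ⟨p - 1, by omega⟩
  obtain ⟨k, rfl⟩ : ∃ k', k = k' + 1 := ⟨k - 1, by omega⟩
  have h0 := choose_add_choose_le a (p + 1) q (k + 1)
  have h1 := Nat.choose_le_choose (k + 1) (show a + q ≤ a + p + q by omega)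
  have h2 : 0 < (a + p + q).choose k := Nat.choose_pos (by omega)
  have h3 := Nat.choose_succ_succ' (a + p + q) k
  have h4 := Nat.choose_succ_succ' (a + q) (k + 1)
  have h5 := Nat.choose_succ_succ' (a + (p + 1) + q) (k + 1)
  rw [show a + (p + 1) + q = (a + p + q) + 1 by omega] at h0 h5
  rw [show a + (p + 1) + (q + 1) = (a + p + q) + 1 + 1 by omega, ← add_assoc a q 1]
  omega

open scoped Classical in
/-- The vertices of `G` not on `F`. -/
noncomputable def outside (ρ : L → ℕ) (o G F : L) : Finset L := ivl ρ o G 1 \ ivl ρ o F 1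

lemma mem_outside {o G F v : L} (hbot : ∀ x, o ≤ x) :
    v ∈ outside ρ o G F ↔ v ≤ G ∧ ρ v = 1 ∧ ¬ v ≤ F := by
  simp only [outside, Finset.mem_sdiff, mem_ivl]
  have := hbot v
  tauto

lemma card_outside {o G F : L} (hFG : F ≤ G) :
    (outside ρ o G F).card + (ivl ρ o F 1).card = (ivl ρ o G 1).card := by
  classical
  refine Finset.card_sdiff_add_card_eq_card fun v hv => ?_
  rw [mem_ivl] at hv ⊢
  exact ⟨hv.1, hv.2.1.trans hFG, hv.2.2⟩

lemma card_ivl_add_card_hits_le {o G F : L} (hbot : ∀ x, o ≤ x) (hFG : F ≤ G) (j : ℕ) :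
    (ivl ρ o F j).card + (hits ρ G ∅ (outside ρ o G F) j).card ≤ (ivl ρ o G j).card := by
  classical
  rw [← Finset.card_union_of_disjoint]
  · refine Finset.card_le_card fun B hB => ?_
    rw [Finset.mem_union, mem_ivl, mem_hits] at hB
    rw [mem_ivl]
    rcases hB with hB | hB
    exacts [⟨hB.1, hB.2.1.trans hFG, hB.2.2⟩, ⟨hbot B, hB.1, hB.2.1⟩]
  · rw [Finset.disjoint_left]
    intro B hB hB'
    rw [mem_ivl] at hB
    rw [mem_hits] at hB'
    obtain ⟨v, hv, hvB⟩ := hB'.2.2.2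
    exact ((mem_outside hbot).1 hv).2.2 (hvB.trans hB.2.1)

lemma exists_facet_two_le_outside (h : FaceRank ρ) {o G : L} (ho : ρ o = 0) (hbot : ∀ x, o ≤ x)
    (hG : ρ G < (ivl ρ o G 1).card) :
    ∃ F, F ≤ G ∧ ρ F + 1 = ρ G ∧ 2 ≤ (outside ρ o G F).card := by
  by_contra! hcon
  refine absurd (h.card_vertices_le (G := G) ho hbot fun F hF hFG => ?_) (by omega)
  have := hcon F hF hFG
  have := card_outside (ρ := ρ) (o := o) hF
  omega

lemma le_card_vertices (h : FaceRank ρ) {o G : L} (ho : ρ o = 0) (hbot : ∀ x, o ≤ x) :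
    ρ G ≤ (ivl ρ o G 1).card := by
  have := h.choose_le_card_ivl (ρ G) 1 o G (hbot G) (by omega)
  simpa [ho] using this

lemma outside_subset {o G F : L} (hbot : ∀ x, o ≤ x) :
    ∀ u ∈ outside ρ o G F, ρ u = 1 ∧ u ≤ G := fun _ hu =>
  ⟨((mem_outside hbot).1 hu).2.1, ((mem_outside hbot).1 hu).1⟩

/-- Grünbaum's lower bound. -/
lemma lower_bound (h : FaceRank ρ) {o : L} (ho : ρ o = 0) (hbot : ∀ x, o ≤ x) {k : ℕ}
    (hk : 1 ≤ k) : ∀ (d s : ℕ) (G : L), ρ G = d + 1 → (ivl ρ o G 1).card = d + s → 1 ≤ s → s ≤ d →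
      (d + 1).choose (k + 1) + d.choose (k + 1)
        ≤ (ivl ρ o G (k + 1)).card + (d + 1 - s).choose (k + 1) := by
  intro d
  induction d with
  | zero => intro s G _ _ h1 h2; omega
  | succ d ih =>
    intro s G hG hV hs hsd
    rcases Nat.lt_or_ge s 2 with hs2 | hs2
    · obtain rfl : s = 1 := by omega
      have := h.choose_le_card_ivl (d + 1 + 1) (k + 1) o G (hbot G) (by omega)
      rw [ho, zero_add] at this
      rw [Nat.add_sub_cancel]
      omega
    · obtain ⟨F, hFG, hF, hr⟩ := h.exists_facet_two_le_outside (G := G) ho hbot (by omega)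
      have hco := card_outside (ρ := ρ) (o := o) hFG
      have hFV := h.le_card_vertices (G := F) ho hbot
      have h1 := card_ivl_add_card_hits_le (ρ := ρ) hbot hFG (k + 1)
      have h2 := h.sum_choose_le_card_hits hk hG _ (outside_subset (F := F) hbot) ∅ (by simp)
        (by simp)
      simp only [Finset.card_empty, Nat.sub_zero] at h2
      set r := (outside ρ o G F).card with hrdef
      have h3 := sum_range_choose_sub (d + 1) k r (by omega)
      have h4 := ih (s + 1 - r) F (by omega) (by omega) (by omega) (by omega)
      have h5 := choose_add_choose_le (d + 1 + 1 - s) (s - r) (r - 2) k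
      rw [show d + 1 + 1 - s + (s - r) = d + 1 + 1 - r by omega,
        show d + 1 + 1 - s + (r - 2) = d + 1 - (s + 1 - r) by omega,
        show d + 1 + 1 - r + (r - 2) = d by omega] at h5
      omega

/-- The consequences, for a facet missing at least two vertices, of equality in Grünbaum's lower
bound. -/
lemma equality_facet (h : FaceRank ρ) {o : L} (ho : ρ o = 0) (hbot : ∀ x, o ≤ x) {k d s : ℕ}
    {G F : L} (hk : 1 ≤ k) (hkd : k + 2 ≤ d) (hG : ρ G = d + 1) (hV : (ivl ρ o G 1).card = d + s)
    (hsd : s ≤ d)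
    (heq : (ivl ρ o G (k + 1)).card + (d + 1 - s).choose (k + 1)
      = (d + 1).choose (k + 1) + d.choose (k + 1))
    (hFG : F ≤ G) (hF : ρ F + 1 = ρ G) (hr : 2 ≤ (outside ρ o G F).card) :
    ((outside ρ o G F).card = 2 ∨ (outside ρ o G F).card = s) ∧
    (hits ρ G ∅ (outside ρ o G F) (k + 1)).card
      ≤ ∑ i ∈ Finset.range (outside ρ o G F).card, (d - i).choose k := by
  have hco := card_outside (ρ := ρ) (o := o) hFG
  have hFV := h.le_card_vertices (G := F) ho hbot
  have h1 := card_ivl_add_card_hits_le (ρ := ρ) hbot hFG (k + 1)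
  have h2 := h.sum_choose_le_card_hits hk hG _ (outside_subset (F := F) hbot) ∅ (by simp) (by simp)
  simp only [Finset.card_empty, Nat.sub_zero] at h2
  set r := (outside ρ o G F).card with hrdef
  have h3 := sum_range_choose_sub d k r (by omega)
  have h4 := h.lower_bound ho hbot hk (d - 1) (s + 1 - r) F (by omega) (by omega) (by omega)
    (by omega)
  have h5 := choose_add_choose_le (d + 1 - s) (s - r) (r - 2) k
  have h6 : 1 ≤ s - r → 1 ≤ r - 2 → _ := fun hp hq =>
    choose_add_choose_lt (a := d + 1 - s) hp hq hk (by omega)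
  rw [show d + 1 - s + (s - r) = d + 1 - r by omega,
    show d + 1 - s + (r - 2) = d - (s + 1 - r) by omega,
    show d + 1 - r + (r - 2) = d - 1 by omega] at h5 h6
  rw [show d - 1 + 1 = d by omega] at h4
  refine ⟨?_, by omega⟩
  by_contra! hne
  have := h6 (by omega) (by omega)
  omega

/-- Equality in Grünbaum's lower bound forces exactly `d + 2` facets. -/
lemma card_facets (h : FaceRank ρ) {o : L} (ho : ρ o = 0) (hbot : ∀ x, o ≤ x) {k d s : ℕ}
    {G : L} (hk : 1 ≤ k) (hkd : k + 2 ≤ d) (hG : ρ G = d + 1) (hV : (ivl ρ o G 1).card = d + s)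
    (hs : 2 ≤ s) (hsd : s ≤ d)
    (heq : (ivl ρ o G (k + 1)).card + (d + 1 - s).choose (k + 1)
      = (d + 1).choose (k + 1) + d.choose (k + 1)) :
    (ivl ρ o G d).card = d + 2 := by
  classical
  obtain ⟨F, hFG, hF, hr⟩ := h.exists_facet_two_le_outside (G := G) ho hbot (by omega)
  obtain ⟨-, hhits⟩ := h.equality_facet ho hbot hk hkd hG hV hsd heq hFG hF hr
  obtain ⟨v, hv, w, hw, hvw⟩ := Finset.one_lt_card.1 (show 1 < (outside ρ o G F).card by omega)
  have step := fun (S₁ : Finset L) (hS₁ : S₁ ⊆ outside ρ o G F) (u : L)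
      (hu : u ∈ outside ρ o G F) (hu₁ : u ∉ S₁) =>
    h.card_hits_singleton_le hk hG (outside_subset hbot) hhits hS₁ hu hu₁
  obtain ⟨hvG, hv1, hvF⟩ := (mem_outside hbot).1 hv
  obtain ⟨hwG, hw1, hwF⟩ := (mem_outside hbot).1 hw
  -- the facets through `v`
  have cv : (ivl ρ v G d).card = d := by
    have e := step ∅ (by simp) v hv (by simp)
    have e' := (Finset.card_le_card (ivl_subset_hits (ρ := ρ) (v := v) (le_refl G) (S := ∅)
      (by simp) (k + 1))).trans e
    have u1 := h.card_coatoms_le k d v G hvG (by omega) hk (by omega)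
      (by rw [hv1, add_comm 1 k]; simpa using e')
    have u2 := h.choose_le_card_ivl d (d - 1) v G hvG (by omega)
    rw [hv1, show 1 + (d - 1) = d by omega] at u1 u2
    rw [Nat.choose_symm (by omega : 1 ≤ d), Nat.choose_one_right] at u2
    omega
  -- the unique facet through `w` avoiding `v`
  obtain ⟨K, hwK, hKG, hKv, hK⟩ := h.exists_avoiding hw1 hwG hG {v} (by simpa using hv1)
    (by simpa using hvw.symm) (by simp; omega)
  rw [Finset.card_singleton] at hK
  have uniq : ∀ K', w ≤ K' → K' ≤ G → ¬ v ≤ K' → ρ K' = d → K' = K := by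
    intro K' h1 h2 h3 h4
    have e := step {v} (by simpa using hv) w hw (by simpa using hvw.symm)
    rw [Finset.card_singleton] at e
    refine h.eq_of_le (h.le_of_card_hits_singleton_le hk hw1 e hwK hKG hKv hK h1 h2
      (by simpa using h3) (by omega)) (by omega)
  -- a facet avoiding both `v` and `w` is `F`
  have rest : ∀ K', K' ≤ G → ¬ v ≤ K' → ¬ w ≤ K' → ρ K' = d → K' = F := by
    intro K' h1 h2 h3 h4
    by_contra hne
    have hnle : ¬ K' ≤ F := fun hle => hne (h.eq_of_le hle (by omega))
    obtain ⟨u, -, huK, hu1, huF⟩ := h.exists_cover (hbot F) _ K' rfl (hbot K') hnle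
    have hu : u ∈ outside ρ o G F := (mem_outside hbot).2 ⟨huK.trans h1, by omega, huF⟩
    have hus : u ∉ ({v, w} : Finset L) := by
      rw [Finset.mem_insert, Finset.mem_singleton]
      rintro (rfl | rfl)
      exacts [h2 huK, h3 huK]
    have e := step {v, w} (by simp [Finset.insert_subset_iff, hv, hw]) u hu hus
    obtain ⟨B, b1, b2, b3, b4⟩ := h.exists_avoiding (show ρ u = 1 by omega) (huK.trans h1) hG
      {v, w} (by simp [hv1, hw1]) hus (by rw [Finset.card_pair hvw]; omega)
    rw [Finset.card_pair hvw] at e b4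
    have hle := h.le_of_card_hits_singleton_le hk (by omega) e b1 b2 b3 b4 huK h1
      (by simp [h2, h3]) (by omega)
    have := h.strictMono.monotone hle
    omega
  have hset : ivl ρ o G d = insert F (insert K (ivl ρ v G d)) := by
    ext B
    simp only [Finset.mem_insert, mem_ivl]
    constructor
    · rintro ⟨-, h1, h2⟩
      by_cases hvB : v ≤ B
      · exact Or.inr (Or.inr ⟨hvB, h1, h2⟩)
      by_cases hwB : w ≤ B
      · exact Or.inr (Or.inl (uniq B hwB h1 hvB h2))
      · exact Or.inl (rest B h1 hvB hwB h2)
    · rintro (rfl | rfl | ⟨-, h1, h2⟩)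
      exacts [⟨hbot _, hFG, by omega⟩, ⟨hbot _, hKG, by omega⟩, ⟨hbot _, h1, h2⟩]
  have hvK : ¬ v ≤ K := hKv v (by simp)
  rw [hset, Finset.card_insert_of_notMem, Finset.card_insert_of_notMem, cv]
  · exact fun e => hvK (mem_ivl.1 e).1
  · rw [Finset.mem_insert, mem_ivl]
    rintro (rfl | e)
    exacts [hwF hwK, hvF e.1]

end FaceRank

section Polytope

variable {N : ℕ} {P F G : Set (EuclideanSpace ℝ (Fin N))}

lemma IsFace.subset (h : IsFace P F) : F ⊆ P := by
  obtain ⟨f, c, -, rfl⟩ := h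
  exact fun x hx => hx.1

lemma isFace_self : IsFace P P := ⟨0, 0, by simp, by simp⟩

lemma isFace_empty : IsFace P ∅ := ⟨0, 1, by simp, by simp⟩

lemma IsFace.inter (hF : IsFace P F) (hG : IsFace P G) : IsFace P (F ∩ G) := by
  obtain ⟨f, c, hf, rfl⟩ := hF
  obtain ⟨g, b, hg, rfl⟩ := hG
  refine ⟨f + g, c + b, fun x hx => add_le_add (hf x hx) (hg x hx), ?_⟩
  ext x
  simp only [mem_inter_iff, mem_ofPred_eq, LinearMap.add_apply]
  constructor
  · rintro ⟨⟨h1, h2⟩, -, h3⟩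
    exact ⟨h1, by rw [h2, h3]⟩
  · rintro ⟨h1, h2⟩
    have := hf x h1
    have := hg x h1
    exact ⟨⟨h1, by linarith⟩, h1, by linarith⟩

lemma IsFace.restrict (hF : IsFace P F) (hG : IsFace P G) (hFG : F ⊆ G) : IsFace G F := by
  obtain ⟨f, c, hf, rfl⟩ := hF
  refine ⟨f, c, fun x hx => hf x (hG.subset hx), ?_⟩
  ext x
  exact ⟨fun hx => ⟨hFG hx, hx.2⟩, fun hx => ⟨hG.subset hx.1, hx.2⟩⟩

lemma le_of_mem_convexHull {V : Set (EuclideanSpace ℝ (Fin N))}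
    (f : EuclideanSpace ℝ (Fin N) →ₗ[ℝ] ℝ) {c : ℝ} (hf : ∀ v ∈ V, f v ≤ c) :
    ∀ x ∈ convexHull ℝ V, f x ≤ c := fun _ hx =>
  convexHull_min (t := {x | f x ≤ c}) hf (convex_halfSpace_le f.isLinear c) hx

/-- A supporting hyperplane section of a polytope is the hull of the generators lying on it. -/
lemma face_eq_convexHull (V : Finset (EuclideanSpace ℝ (Fin N)))
    (f : EuclideanSpace ℝ (Fin N) →ₗ[ℝ] ℝ) (c : ℝ) (hf : ∀ v ∈ V, f v ≤ c) :
    {x ∈ convexHull ℝ (V : Set (EuclideanSpace ℝ (Fin N))) | f x = c}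
      = convexHull ℝ {v ∈ (V : Set (EuclideanSpace ℝ (Fin N))) | f v = c} := by
  apply Subset.antisymm
  · rintro x ⟨hx, hfx⟩
    obtain ⟨w, hw0, hw1, rfl⟩ := Finset.mem_convexHull'.1 hx
    have hz : ∑ v ∈ V, w v * (c - f v) = 0 := by
      simp only [map_sum, map_smul, smul_eq_mul] at hfx
      simp only [mul_sub, Finset.sum_sub_distrib, ← Finset.sum_mul, hw1, hfx]
      ring
    rw [Finset.sum_eq_zero_iff_of_nonneg
      fun v hv => mul_nonneg (hw0 v hv) (sub_nonneg.2 (hf v hv))] at hz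
    classical
    have hne : ∀ v ∈ V, w v ≠ 0 → f v = c := by
      intro v hv hwv
      rcases mul_eq_zero.1 (hz v hv) with h | h
      exacts [absurd h hwv, by linarith]
    have e1 : ∑ v ∈ V.filter (fun v => f v = c), w v = 1 := by
      rw [← hw1]
      exact Finset.sum_filter_of_ne hne
    have e2 : ∑ v ∈ V.filter (fun v => f v = c), w v • v = ∑ v ∈ V, w v • v :=
      Finset.sum_filter_of_ne fun v hv h => hne v hv fun h0 => h (by rw [h0, zero_smul])
    rw [← e2]
    have := Finset.mem_convexHull'.2
      ⟨w, fun v hv => hw0 v (Finset.mem_of_mem_filter v hv), e1, rfl⟩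
    simpa using this
  · refine fun x hx => ⟨convexHull_mono (fun v hv => hv.1) hx, ?_⟩
    exact convexHull_min (t := {x | f x = c}) (fun v hv => hv.2)
      (convex_hyperplane f.isLinear c) hx

lemma IsFace.eq_convexHull {V : Finset (EuclideanSpace ℝ (Fin N))}
    (hF : IsFace (convexHull ℝ (V : Set (EuclideanSpace ℝ (Fin N)))) F) :
    F = convexHull ℝ {v ∈ (V : Set (EuclideanSpace ℝ (Fin N))) | v ∈ F} := by
  obtain ⟨f, c, hf, hFeq⟩ := hF
  have h := face_eq_convexHull V f c fun v hv => hf v (subset_convexHull ℝ _ hv)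
  rw [← hFeq] at h
  rw [h]
  congr 1
  ext v
  simp only [mem_ofPred_eq, ← h]
  refine and_congr_right fun hv => ?_
  rw [hFeq]
  exact ⟨fun e => ⟨subset_convexHull ℝ _ hv, e⟩, fun e => e.2⟩

lemma IsFace.isPolytope (hP : IsPolytope P) (hF : IsFace P F) : IsPolytope F := by
  classical
  obtain ⟨V, rfl⟩ := hP
  refine ⟨V.filter (· ∈ F), ?_⟩
  rw [Finset.coe_filter]
  exact hF.eq_convexHull

lemma IsPolytope.finite_faces (hP : IsPolytope P) : {F | IsFace P F}.Finite := by
  obtain ⟨V, rfl⟩ := hP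
  refine Set.Finite.subset ((V.finite_toSet.powerset).image (convexHull ℝ ·)) ?_
  intro F hF
  exact ⟨_, fun v hv => hv.1, (IsFace.eq_convexHull hF).symm⟩

lemma IsFace.trans (hP : IsPolytope P) (hG : IsFace P G) (hF : IsFace G F) : IsFace P F := by
  obtain ⟨V, rfl⟩ := hP
  obtain ⟨g, b, hg, rfl⟩ := hG
  obtain ⟨f, c, hf, rfl⟩ := hF
  have hgV : ∀ v ∈ V, g v ≤ b := fun v hv => hg v (subset_convexHull ℝ _ hv)
  obtain ⟨M, hM⟩ : ∃ M : ℝ, ∀ v ∈ V, g v < b → f v + M * g v < c + M * b := by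
    obtain ⟨M, hM⟩ := (V.image fun v => (f v - c) / (b - g v)).bddAbove
    refine ⟨M + 1, fun v hv hlt => ?_⟩
    have h1 : (f v - c) / (b - g v) < M + 1 :=
      (hM (Finset.mem_coe.2 (Finset.mem_image_of_mem _ hv))).trans_lt (lt_add_one M)
    rw [div_lt_iff₀ (sub_pos.2 hlt)] at h1
    linarith
  have hle : ∀ v ∈ V, (f + M • g) v ≤ c + M * b := by
    intro v hv
    simp only [LinearMap.add_apply, LinearMap.smul_apply, smul_eq_mul]
    rcases (hgV v hv).lt_or_eq with h | h
    · exact (hM v hv h).le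
    · rw [h]
      have := hf v ⟨subset_convexHull ℝ _ hv, h⟩
      linarith
  refine ⟨f + M • g, c + M * b, le_of_mem_convexHull _ hle, ?_⟩
  rw [face_eq_convexHull V _ _ hle]
  apply Subset.antisymm
  · rintro x ⟨hxG, hfx⟩
    rw [← face_eq_convexHull V _ _ hle]
    refine ⟨hxG.1, ?_⟩
    simp only [LinearMap.add_apply, LinearMap.smul_apply, smul_eq_mul, hfx, hxG.2]
  · have hsub : {v ∈ (V : Set (EuclideanSpace ℝ (Fin N))) | (f + M • g) v = c + M * b}
        ⊆ {x ∈ {x ∈ convexHull ℝ (V : Set (EuclideanSpace ℝ (Fin N))) | g x = b} | f x = c} := by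
      rintro v ⟨hv, hve⟩
      simp only [LinearMap.add_apply, LinearMap.smul_apply, smul_eq_mul] at hve
      have hgv : g v = b := by
        refine (hgV v hv).eq_of_not_lt fun h => ?_
        exact (hM v hv h).ne hve
      rw [hgv] at hve
      exact ⟨⟨subset_convexHull ℝ _ hv, hgv⟩, by linarith⟩
    refine convexHull_min hsub ?_
    have hset : {x ∈ {x ∈ convexHull ℝ (V : Set (EuclideanSpace ℝ (Fin N))) | g x = b} | f x = c}
        = convexHull ℝ (V : Set (EuclideanSpace ℝ (Fin N))) ∩ {x | g x = b} ∩ {x | f x = c} := rfl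
    rw [hset]
    exact ((convex_convexHull ℝ _).inter (convex_hyperplane g.isLinear b)).inter
      (convex_hyperplane f.isLinear c)

open scoped Classical in
/-- The rank of a face: its dimension plus one, and zero for the empty face. -/
noncomputable def faceRank (F : Set (EuclideanSpace ℝ (Fin N))) : ℕ :=
  if F = ∅ then 0 else pdim F + 1

lemma faceRank_empty : faceRank (∅ : Set (EuclideanSpace ℝ (Fin N))) = 0 := if_pos rfl

lemma faceRank_of_nonempty (h : F.Nonempty) : faceRank F = pdim F + 1 := if_neg h.ne_empty

lemma faceRank_eq_succ {k : ℕ} : faceRank F = k + 1 ↔ F.Nonempty ∧ pdim F = k := by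
  rcases F.eq_empty_or_nonempty with rfl | h
  · simp [faceRank_empty]
  · simp [faceRank_of_nonempty h, h]

lemma pdim_lt_pdim (hF : IsFace P F) (hFP : F ⊂ P) (hne : F.Nonempty) : pdim F < pdim P := by
  refine Submodule.finrank_lt_finrank_of_lt (AffineSubspace.direction_lt_of_nonempty ?_
    (hne.affineSpan ℝ))
  refine lt_of_le_of_ne (affineSpan_mono ℝ hFP.subset) fun heq => hFP.2 fun p hp => ?_
  obtain ⟨f, c, hf, rfl⟩ := hF
  refine ⟨hp, ?_⟩
  have hp' : p ∈ affineSpan ℝ {x ∈ P | f x = c} := heq ▸ subset_affineSpan ℝ _ hp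
  have hle : affineSpan ℝ {x ∈ P | f x = c}
      ≤ (affineSpan ℝ {c}).comap f.toAffineMap := by
    rw [affineSpan_le]
    rintro x ⟨-, hx⟩
    simp [hx]
  simpa using hle hp'

lemma faceRank_lt_faceRank (hF : IsFace P F) (hFP : F ⊂ P) : faceRank F < faceRank P := by
  obtain ⟨p, hp, -⟩ := exists_of_ssubset hFP
  rw [faceRank_of_nonempty ⟨p, hp⟩]
  rcases F.eq_empty_or_nonempty with rfl | h
  · simp [faceRank_empty]
  · rw [faceRank_of_nonempty h]
    exact Nat.succ_lt_succ (pdim_lt_pdim hF hFP h)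

lemma finrank_vectorSpan_insert_le_faceRank (a : EuclideanSpace ℝ (Fin N)) :
    Module.finrank ℝ (vectorSpan ℝ (insert a F)) ≤ faceRank F := by
  rcases F.eq_empty_or_nonempty with rfl | h
  · rw [insert_empty_eq, vectorSpan_singleton, finrank_bot]
    exact Nat.zero_le _
  · rw [faceRank_of_nonempty h, pdim, direction_affineSpan]
    exact finrank_vectorSpan_insert_le_set ℝ F a

/-- A proper face of non-maximal rank that misses `a` can be enlarged to a bigger face
missing `a`. -/
lemma exists_larger_face (hP : IsPolytope P) (hF : IsFace P F) {a : EuclideanSpace ℝ (Fin N)}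
    (ha : a ∈ P) (haF : a ∉ F) (hr : faceRank F + 1 < faceRank P) :
    ∃ H, IsFace P H ∧ F ⊂ H ∧ a ∉ H := by
  classical
  rw [faceRank_of_nonempty ⟨a, ha⟩, pdim, direction_affineSpan] at hr
  obtain ⟨p, hp, hpW⟩ : ∃ p ∈ P, p -ᵥ a ∉ vectorSpan ℝ (insert a F) := by
    by_contra! hcon
    have hle : vectorSpan ℝ P ≤ vectorSpan ℝ (insert a F) := by
      rw [vectorSpan_eq_span_vsub_set_right ℝ ha, Submodule.span_le]
      rintro _ ⟨p, hp, rfl⟩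
      exact hcon p hp
    have := Submodule.finrank_mono hle
    have := finrank_vectorSpan_insert_le_faceRank (F := F) a
    omega
  obtain ⟨g, hgp, hgW⟩ : ∃ g : EuclideanSpace ℝ (Fin N) →ₗ[ℝ] ℝ,
      g a < g p ∧ ∀ x ∈ F, g x = g a := by
    obtain ⟨g, hgp, hgW⟩ := Submodule.exists_le_ker_of_notMem hpW
    have hgF : ∀ x ∈ F, g x = g a := by
      intro x hx
      have := hgW (vsub_mem_vectorSpan ℝ (mem_insert_of_mem a hx) (mem_insert a F))
      rw [LinearMap.mem_ker, vsub_eq_sub, map_sub] at this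
      linarith
    rw [vsub_eq_sub, map_sub, sub_ne_zero] at hgp
    rcases hgp.lt_or_gt with h | h
    · exact ⟨-g, by simpa using h, fun x hx => by simp [hgF x hx]⟩
    · exact ⟨g, h, hgF⟩
  obtain ⟨V, rfl⟩ := hP
  obtain ⟨f, c, hf, rfl⟩ := hF
  have hfV : ∀ v ∈ V, f v ≤ c := fun v hv => hf v (subset_convexHull ℝ _ hv)
  have hne : (V.filter fun v => g a < g v).Nonempty := by
    by_contra hcon
    rw [Finset.not_nonempty_iff_eq_empty, Finset.filter_eq_empty_iff] at hcon
    exact (le_of_mem_convexHull g (fun v hv => not_lt.1 (hcon hv)) p hp).not_gt hgp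
  obtain ⟨v₀, hv₀, hmin⟩ := Finset.exists_min_image _
    (fun v => (c - f v) / (g v - g a)) hne
  rw [Finset.mem_filter] at hv₀
  set t := (c - f v₀) / (g v₀ - g a) with ht
  have ht0 : 0 ≤ t := div_nonneg (sub_nonneg.2 (hfV v₀ hv₀.1)) (sub_pos.2 hv₀.2).le
  have hle : ∀ v ∈ V, (f + t • g) v ≤ c + t * g a := by
    intro v hv
    simp only [LinearMap.add_apply, LinearMap.smul_apply, smul_eq_mul]
    rcases lt_or_ge (g a) (g v) with h | h
    · have := hmin v (Finset.mem_filter.2 ⟨hv, h⟩)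
      rw [le_div_iff₀ (sub_pos.2 h)] at this
      linarith
    · have := mul_le_mul_of_nonneg_left h ht0
      have := hfV v hv
      linarith
  refine ⟨_, ⟨f + t • g, c + t * g a, le_of_mem_convexHull _ hle, rfl⟩, ?_, ?_⟩
  · refine ssubset_of_subset_of_ne (fun x hx => ⟨hx.1, ?_⟩) fun heq => ?_
    · simp only [LinearMap.add_apply, LinearMap.smul_apply, smul_eq_mul, hgW x hx, hx.2]
    · have hv₀P := subset_convexHull ℝ (V : Set (EuclideanSpace ℝ (Fin N))) hv₀.1
      have hmem : v₀ ∈ {x ∈ convexHull ℝ (V : Set (EuclideanSpace ℝ (Fin N))) |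
          (f + t • g) x = c + t * g a} := by
        refine ⟨hv₀P, ?_⟩
        have : t * (g v₀ - g a) = c - f v₀ := div_mul_cancel₀ _ (sub_pos.2 hv₀.2).ne'
        simp only [LinearMap.add_apply, LinearMap.smul_apply, smul_eq_mul]
        linarith
      rw [← heq] at hmem
      exact hv₀.2.ne' (hgW v₀ hmem)
  · rintro ⟨-, h⟩
    simp only [LinearMap.add_apply, LinearMap.smul_apply, smul_eq_mul] at h
    exact haF ⟨ha, by linarith⟩

/-- Every face of a polytope missing the point `a` lies in a facet missing `a`. -/
lemma exists_facet_notMem (hP : IsPolytope P) (hF : IsFace P F) {a : EuclideanSpace ℝ (Fin N)}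
    (ha : a ∈ P) (haF : a ∉ F) :
    ∃ H, IsFace P H ∧ F ⊆ H ∧ a ∉ H ∧ faceRank H + 1 = faceRank P := by
  have hfin : {H | IsFace P H ∧ F ⊆ H ∧ a ∉ H}.Finite :=
    hP.finite_faces.subset fun H hH => hH.1
  obtain ⟨H, hH⟩ := hfin.exists_maximal ⟨F, hF, subset_rfl, haF⟩
  refine ⟨H, hH.prop.1, hH.prop.2.1, hH.prop.2.2, ?_⟩
  have hlt := faceRank_lt_faceRank hH.prop.1
    (ssubset_of_subset_of_ne hH.prop.1.subset (by rintro rfl; exact hH.prop.2.2 ha))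
  by_contra hne
  obtain ⟨K, k1, k2, k3⟩ := exists_larger_face hP hH.prop.1 ha hH.prop.2.2 (by omega)
  exact k2.2 (hH.le_of_ge ⟨k1, hH.prop.2.1.trans k2.1, k3⟩ k2.1)

instance : SemilatticeInf {F : Set (EuclideanSpace ℝ (Fin N)) // IsFace P F} :=
  Subtype.semilatticeInf fun _ _ => IsFace.inter

lemma IsPolytope.faceRank_isFaceRank (hP : IsPolytope P) :
    FaceRank fun F : {F : Set (EuclideanSpace ℝ (Fin N)) // IsFace P F} => faceRank F.1 where
  strictMono F G hFG := faceRank_lt_faceRank (F.2.restrict G.2 hFG.le) hFG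
  exists_facet x y G hxG hyG hyx := by
    obtain ⟨a, hay, hax⟩ := Set.not_subset.1 (show ¬ y.1 ⊆ x.1 from hyx)
    obtain ⟨H, h1, h2, h3, h4⟩ := exists_facet_notMem (G.2.isPolytope hP)
      (x.2.restrict G.2 hxG) (hyG hay) hax
    exact ⟨⟨H, G.2.trans hP h1⟩, h2, h1.subset, h4, fun hyH => h3 (hyH hay)⟩

lemma fCount_eq_card_ivl [Fintype {F : Set (EuclideanSpace ℝ (Fin N)) // IsFace P F}]
    (hP : IsPolytope P) (G : {F : Set (EuclideanSpace ℝ (Fin N)) // IsFace P F}) (k : ℕ) :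
    fCount G.1 k = (FaceRank.ivl (fun F : {F : Set (EuclideanSpace ℝ (Fin N)) // IsFace P F} =>
      faceRank F.1) ⟨∅, isFace_empty⟩ G (k + 1)).card := by
  rw [fCount, ← Set.ncard_coe_finset, ← Set.ncard_image_of_injective _ Subtype.val_injective]
  congr 1
  ext F
  simp only [mem_ofPred_eq, mem_image, Finset.mem_coe, FaceRank.mem_ivl, faceRank_eq_succ,
    Subtype.exists, exists_and_right, exists_eq_right]
  constructor
  · rintro ⟨h1, h2⟩
    exact ⟨G.2.trans hP h1, Set.empty_subset F, h1.subset, h2⟩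
  · rintro ⟨h1, -, h2, h3⟩
    exact ⟨h1.restrict G.2 h2, h3⟩

lemma ncard_vertexSet (F : Set (EuclideanSpace ℝ (Fin N))) :
    (vertexSet F).ncard = fCount F 0 := by
  rw [fCount, ← Set.ncard_image_of_injective _ Set.singleton_injective]
  congr 1
  ext G
  constructor
  · rintro ⟨v, hv, rfl⟩
    exact ⟨hv, singleton_nonempty v, by simp [pdim, direction_affineSpan]⟩
  · rintro ⟨hG, ⟨v, hv⟩, h0⟩
    have hsub : G = {v} := by
      refine Subset.antisymm (fun w hw => ?_) (singleton_subset_iff.2 hv)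
      rw [pdim, direction_affineSpan, Submodule.finrank_eq_zero] at h0
      have := vsub_mem_vectorSpan ℝ hw hv
      rw [h0, Submodule.mem_bot, vsub_eq_zero_iff_eq] at this
      exact this
    exact ⟨v, by rw [vertexSet, mem_ofPred_eq, ← hsub]; exact hG, hsub.symm⟩

end Polytope

lemma phi_add_choose {d s : ℕ} (hs : s ≤ d) (k : ℕ) :
    phi d s k + ((d + 1 - s).choose (k + 1) : ℕ)
      = ((d + 1).choose (k + 1) + d.choose (k + 1) : ℕ) := by
  have h1 : C ((d : ℤ) + 1) (k + 1) = ((d + 1).choose (k + 1) : ℕ) := by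
    rw [C, if_neg (by omega), show ((d : ℤ) + 1).toNat = d + 1 by omega]
  have h2 : C (d : ℤ) (k + 1) = (d.choose (k + 1) : ℕ) := by
    rw [C, if_neg (by omega), Int.toNat_natCast]
  have h3 : C ((d : ℤ) + 1 - s) (k + 1) = ((d + 1 - s).choose (k + 1) : ℕ) := by
    rw [C, if_neg (by omega), show ((d : ℤ) + 1 - s).toNat = d + 1 - s by omega]
  rw [phi, h1, h2, h3]
  push_cast
  ring

theorem stmt8 {N : ℕ} (P : Set (EuclideanSpace ℝ (Fin N))) (d s k : ℕ)
    (hP : IsPolytope P) (hdim : pdim P = d)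
    (hvert : (vertexSet P).ncard = d + s)
    (hs : 2 ≤ s) (hsd : s ≤ d) (hk1 : 1 ≤ k) (hk2 : k ≤ d - 2)
    (heq : (fCount P k : ℤ) = phi d s k) :
    (∀ F, IsFace P F → F.Nonempty → pdim F = d - 1 →
      (vertexSet F).ncard = d ∨ (vertexSet F).ncard = d + s - 2 ∨
        (vertexSet F).ncard = d + s - 1) ∧
    fCount P (d - 1) = d + 2 := by
  have : Finite {F : Set (EuclideanSpace ℝ (Fin N)) // IsFace P F} := hP.finite_faces.to_subtype
  have := Fintype.ofFinite {F : Set (EuclideanSpace ℝ (Fin N)) // IsFace P F}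
  have hne : P.Nonempty := by
    rw [Set.nonempty_iff_ne_empty]
    rintro rfl
    rw [pdim, direction_affineSpan, vectorSpan_empty, finrank_bot] at hdim
    omega
  have h := hP.faceRank_isFaceRank
  set ρ := fun F : {F : Set (EuclideanSpace ℝ (Fin N)) // IsFace P F} => faceRank F.1 with hρ
  set o : {F : Set (EuclideanSpace ℝ (Fin N)) // IsFace P F} := ⟨∅, isFace_empty⟩ with ho
  have ho0 : ρ o = 0 := faceRank_empty
  have hbot : ∀ x, o ≤ x := fun x => Set.empty_subset x.1
  have hcount : ∀ (G : {F : Set (EuclideanSpace ℝ (Fin N)) // IsFace P F}) (j : ℕ),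
      fCount G.1 j = (FaceRank.ivl ρ o G (j + 1)).card := fCount_eq_card_ivl hP
  set T : {F : Set (EuclideanSpace ℝ (Fin N)) // IsFace P F} := ⟨P, isFace_self⟩ with hT
  have hT1 : ρ T = d + 1 := faceRank_eq_succ.2 ⟨hne, hdim⟩
  have hV : (FaceRank.ivl ρ o T 1).card = d + s := by
    rw [← hvert, ncard_vertexSet]
    exact (hcount T 0).symm
  have hk : (FaceRank.ivl ρ o T (k + 1)).card + (d + 1 - s).choose (k + 1)
      = (d + 1).choose (k + 1) + d.choose (k + 1) := by
    have h1 := phi_add_choose hsd k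
    rw [← heq, show fCount P k = _ from hcount T k] at h1
    exact_mod_cast h1
  constructor
  · intro F hF hFne hFd
    set K : {F : Set (EuclideanSpace ℝ (Fin N)) // IsFace P F} := ⟨F, hF⟩ with hK
    have hKT : K ≤ T := hF.subset
    have hK1 : ρ K + 1 = ρ T := by
      rw [hT1, show ρ K = d - 1 + 1 from faceRank_eq_succ.2 ⟨hFne, hFd⟩]
      omega
    have hco := FaceRank.card_outside (ρ := ρ) (o := o) hKT
    obtain ⟨v, -, hvT, hv1, hvK⟩ := h.exists_cover (hbot K) _ T rfl (hbot T)
      (h.not_le_of_rank_lt (by omega))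
    have hpos : 0 < (FaceRank.outside ρ o T K).card :=
      Finset.card_pos.2 ⟨v, (FaceRank.mem_outside hbot).2 ⟨hvT, by omega, hvK⟩⟩
    rw [ncard_vertexSet, show fCount F 0 = _ from hcount K 0, zero_add]
    rcases Nat.lt_or_ge (FaceRank.outside ρ o T K).card 2 with hr | hr
    · omega
    · have := (h.equality_facet ho0 hbot hk1 (by omega) hT1 hV hsd hk hKT hK1 hr).1
      omega
  · rw [show fCount P (d - 1) = _ from hcount T (d - 1), show d - 1 + 1 = d by omega]
    exact h.card_facets ho0 hbot hk1 (by omega) hT1 hV hs hsd hk
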